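/- Let q be a power of two, let k ≥ 2, and let f ∈ F_q[x] be of the form f(x) = Σ_{i=1}^{2^{k-1}} a_{2i} x^{2i} with a_{2^k} ≠ 0. If Φ_f is not absolutely irreducible (i.e., Φ_f is reducible over the algebraic closure of F_q), then there exists θ ∈ F_{2^k} \ F_2 (inside a fixed algebraic closure of F_q) such that for every i ∈ {1, 2, ..., 2^{k-1}}, either a_{2i} = 0 or the linear form x + z + θ(y+z) divides φ_{2i}(x,y,z) over the algebraic closure. -/

import Mathlib

/-- The denominator `(x+y)(x+z)(y+z)` as a polynomial in the variables
`x = X 0`, `y = X 1`, `z = X 2`. -/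
noncomputable def denom (F : Type*) [Field F] : MvPolynomial (Fin 3) F :=
  (MvPolynomial.X 0 + MvPolynomial.X 1) * (MvPolynomial.X 0 + MvPolynomial.X 2) *
    (MvPolynomial.X 1 + MvPolynomial.X 2)

/-- The numerator `x(f(y)+f(z)) + y(f(x)+f(z)) + z(f(x)+f(y))` of `Φ_f`;
`Φ_f` is the (exact) quotient of `numer F f` by `denom F`. -/
noncomputable def numer (F : Type*) [Field F] (f : Polynomial F) : MvPolynomial (Fin 3) F :=
  MvPolynomial.X 0 *
      (Polynomial.aeval (MvPolynomial.X 1) f + Polynomial.aeval (MvPolynomial.X 2) f) +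
    MvPolynomial.X 1 *
      (Polynomial.aeval (MvPolynomial.X 0) f + Polynomial.aeval (MvPolynomial.X 2) f) +
    MvPolynomial.X 2 *
      (Polynomial.aeval (MvPolynomial.X 0) f + Polynomial.aeval (MvPolynomial.X 1) f)

/-- The numerator `x(y^j+z^j) + y(x^j+z^j) + z(x^j+y^j)` of `φ_j`;
`φ_j` is the (exact) quotient of `numerMon F j` by `denom F`. -/
noncomputable def numerMon (F : Type*) [Field F] (j : ℕ) : MvPolynomial (Fin 3) F :=
  MvPolynomial.X 0 * (MvPolynomial.X 1 ^ j + MvPolynomial.X 2 ^ j) +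
    MvPolynomial.X 1 * (MvPolynomial.X 0 ^ j + MvPolynomial.X 2 ^ j) +
    MvPolynomial.X 2 * (MvPolynomial.X 0 ^ j + MvPolynomial.X 1 ^ j)

/-- A polynomial over `F` has an absolutely irreducible factor over `F` if it has a
nonconstant factor with coefficients in `F` that stays irreducible over the algebraic
closure of `F`. -/
def HasAbsIrredFactor (F : Type*) [Field F] (P : MvPolynomial (Fin 3) F) : Prop :=
  ∃ g : MvPolynomial (Fin 3) F, g ∣ P ∧ 0 < g.totalDegree ∧
    Irreducible (MvPolynomial.map (algebraMap F (AlgebraicClosure F)) g)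

lemma hom_prod_field {K : Type*} [Field K] [IsAlgClosed K] {q : ℕ} (hq : 1 < q)
    {L : Type*} [Field L] [Algebra K L] (u v : L) (hv : v ≠ 0) :
    (((Polynomial.X ^ q - Polynomial.X : Polynomial K).roots).map
      (fun r => u - algebraMap K L r * v)).prod = u ^ q - u * v ^ (q - 1) := by
  set g : Polynomial K := Polynomial.X ^ q - Polynomial.X with hg
  have hdeg : g.natDegree = q := FiniteField.X_pow_card_sub_X_natDegree_eq K hq
  have hmon : g.Monic := by
    rw [hg]; apply Polynomial.monic_X_pow_sub
    rw [Polynomial.degree_X]; exact_mod_cast hq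
  have hs : g.Splits := IsAlgClosed.splits g
  have hcard : Multiset.card g.roots = q := by rw [← hdeg]; exact hs.natDegree_eq_card_roots.symm
  have h1 := congrArg (Polynomial.aeval (u / v)) (hs.eq_prod_roots_of_monic hmon)
  rw [map_multiset_prod, Multiset.map_map] at h1
  simp only [Function.comp_def, map_sub, Polynomial.aeval_X, Polynomial.aeval_C] at h1
  have h2 : (Multiset.map (fun r => u - algebraMap K L r * v) g.roots)
      = Multiset.map (fun r => v * (u / v - algebraMap K L r)) g.roots := by
    apply Multiset.map_congr rfl
    intro r _
    field_simp
  rw [h2, Multiset.prod_map_mul, Multiset.map_const', Multiset.prod_replicate, hcard, ← h1, hg]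
  obtain ⟨n, rfl⟩ : ∃ n, q = n + 1 := ⟨q - 1, by omega⟩
  simp only [map_sub, map_pow, Polynomial.aeval_X, add_tsub_cancel_right, div_pow]
  field_simp
  try ring

lemma hom_prod {K : Type*} [Field K] [IsAlgClosed K] {q : ℕ} (hq : 1 < q)
    {A : Type*} [CommRing A] [IsDomain A] [Algebra K A] (u v : A) (hv : v ≠ 0) :
    (((Polynomial.X ^ q - Polynomial.X : Polynomial K).roots).map
      (fun r => u - algebraMap K A r * v)).prod = u ^ q - u * v ^ (q - 1) := by
  apply IsFractionRing.injective A (FractionRing A)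
  have h := hom_prod_field (K := K) hq (algebraMap A (FractionRing A) u)
    (algebraMap A (FractionRing A) v) (by simpa using hv)
  rw [map_multiset_prod, Multiset.map_map]
  simp only [Function.comp_def, map_sub, map_mul, map_pow,
    ← IsScalarTower.algebraMap_apply K A (FractionRing A)]
  exact h

open MvPolynomial in
lemma prime_dvd_lin {K : Type*} [Field K] [IsAlgClosed K] [CharP K 2] {q : ℕ} (hq : 1 < q)
    (u v p : MvPolynomial (Fin 3) K) (hv : v ≠ 0) (hp : Prime p) (h : p ∣ u * v ^ q + v * u ^ q) :
    p ∣ v ∨ ∃ θ : K, θ ^ q = θ ∧ p ∣ u + C θ * v := by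
  have h2 : (2 : MvPolynomial (Fin 3) K) = 0 := CharTwo.two_eq_zero
  have e : u * v ^ q + v * u ^ q = v * (u ^ q - u * v ^ (q - 1)) := by
    obtain ⟨n, rfl⟩ : ∃ n, q = n + 1 := ⟨q - 1, by omega⟩
    simp
    linear_combination u * v ^ (n+1) * h2
  rw [e, ← hom_prod (K := K) hq u v hv] at h
  rcases hp.dvd_or_dvd h with h | h
  · exact Or.inl h
  · right
    obtain ⟨a, ha, hpa⟩ := hp.exists_mem_multiset_map_dvd h
    refine ⟨a, ?_, ?_⟩
    · have := Polynomial.isRoot_of_mem_roots ha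
      simpa [Polynomial.IsRoot, sub_eq_zero] using this
    · rw [← CharTwo.sub_eq_add]; exact hpa

/-- linear forms squared do not divide -/
lemma lin_sq_not_dvd {K : Type*} [Field K] [CharP K 2] {k : ℕ} (hk : 1 ≤ k) 
    (l c : MvPolynomial (Fin 3) K)
    (e : l * l * c = MvPolynomial.X 0 * MvPolynomial.X 1 ^ (2 ^ k)
      + MvPolynomial.X 1 * MvPolynomial.X 0 ^ (2 ^ k)) (w : Fin 3 → K)
    (hw : MvPolynomial.eval w l = 0) : w 0 = 0 ∧ w 1 = 0 := by
  have hz : ((2 ^ k : ℕ) : MvPolynomial (Fin 3) K) = 0 := by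
    rw [Nat.cast_pow, Nat.cast_two, CharTwo.two_eq_zero, zero_pow (by omega)]
  have h0 := congrArg (fun P => MvPolynomial.eval w (MvPolynomial.pderiv 0 P)) e
  have h1 := congrArg (fun P => MvPolynomial.eval w (MvPolynomial.pderiv 1 P)) e
  simp [Derivation.leibniz, Derivation.leibniz_pow, hw, MvPolynomial.pderiv_X, CharTwo.two_eq_zero] at h0 h1
  have hk' : k ≠ 0 := by omega
  simp [hk'] at h0 h1
  exact ⟨(pow_eq_zero_iff (by positivity)).mp h1.symm, (pow_eq_zero_iff (by positivity)).mp h0.symm⟩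

/-- Change of variables `x = u+z`, `y = v+z` combined with the total degree grading. -/
noncomputable def alphaHom (K : Type*) [Field K] :
    MvPolynomial (Fin 3) K →ₐ[K] Polynomial (MvPolynomial (Fin 3) K) :=
  MvPolynomial.aeval ![
    Polynomial.C (MvPolynomial.X 0 + MvPolynomial.X 2) * Polynomial.X,
    Polynomial.C (MvPolynomial.X 1 + MvPolynomial.X 2) * Polynomial.X,
    Polynomial.C (MvPolynomial.X 2) * Polynomial.X]

/-- Inverse change of variables (characteristic two). -/
noncomputable def betaHom (K : Type*) [Field K] :
    MvPolynomial (Fin 3) K →ₐ[K] MvPolynomial (Fin 3) K :=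
  MvPolynomial.aeval ![MvPolynomial.X 0 + MvPolynomial.X 2,
    MvPolynomial.X 1 + MvPolynomial.X 2, MvPolynomial.X 2]

/-- Numerator in the new coordinates. -/
noncomputable def newNum (K : Type*) [Field K] (j : ℕ) : MvPolynomial (Fin 3) K :=
  MvPolynomial.X 0 * ((MvPolynomial.X 1 + MvPolynomial.X 2) ^ j + MvPolynomial.X 2 ^ j) +
    MvPolynomial.X 1 * ((MvPolynomial.X 0 + MvPolynomial.X 2) ^ j + MvPolynomial.X 2 ^ j)

/-- Denominator in the new coordinates. -/
noncomputable def newDen (K : Type*) [Field K] : MvPolynomial (Fin 3) K :=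
  (MvPolynomial.X 0 + MvPolynomial.X 1) * MvPolynomial.X 0 * MvPolynomial.X 1

section char2
set_option linter.unusedSectionVars false
variable {K : Type*} [Field K] [CharP K 2]

lemma two_A : (2 : MvPolynomial (Fin 3) K) = 0 := CharTwo.two_eq_zero

lemma two_AT : (2 : Polynomial (MvPolynomial (Fin 3) K)) = 0 := CharTwo.two_eq_zero

lemma alpha_X0 : alphaHom K (MvPolynomial.X 0) =
    Polynomial.C (MvPolynomial.X 0 + MvPolynomial.X 2) * Polynomial.X := by simp [alphaHom]

lemma alpha_X1 : alphaHom K (MvPolynomial.X 1) =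
    Polynomial.C (MvPolynomial.X 1 + MvPolynomial.X 2) * Polynomial.X := by simp [alphaHom]

lemma alpha_X2 : alphaHom K (MvPolynomial.X 2) =
    Polynomial.C (MvPolynomial.X 2) * Polynomial.X := by simp [alphaHom]

lemma beta_X0 : betaHom K (MvPolynomial.X 0) = MvPolynomial.X 0 + MvPolynomial.X 2 := by
  simp [betaHom]

lemma beta_X1 : betaHom K (MvPolynomial.X 1) = MvPolynomial.X 1 + MvPolynomial.X 2 := by
  simp [betaHom]

lemma beta_X2 : betaHom K (MvPolynomial.X 2) = MvPolynomial.X 2 := by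
  simp [betaHom]

lemma beta_alpha_X (i : Fin 3) :
    betaHom K ((alphaHom K (MvPolynomial.X i)).eval 1) = MvPolynomial.X i := by
  match i with
  | 0 => rw [alpha_X0, Polynomial.eval_mul, Polynomial.eval_C, Polynomial.eval_X, mul_one,
      map_add, beta_X0, beta_X2]; exact CharTwo.add_cancel_right _ _
  | 1 => rw [alpha_X1, Polynomial.eval_mul, Polynomial.eval_C, Polynomial.eval_X, mul_one,
      map_add, beta_X1, beta_X2]; exact CharTwo.add_cancel_right _ _
  | 2 => rw [alpha_X2, Polynomial.eval_mul, Polynomial.eval_C, Polynomial.eval_X, mul_one, beta_X2]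

lemma beta_alpha (p : MvPolynomial (Fin 3) K) :
    betaHom K ((alphaHom K p).eval 1) = p := by
  induction p using MvPolynomial.induction_on with
  | C a =>
    have : alphaHom K (MvPolynomial.C a) = Polynomial.C (MvPolynomial.C a) := by
      simp [alphaHom, MvPolynomial.algebraMap_eq, Polynomial.algebraMap_apply]
    rw [this]
    simp [betaHom, MvPolynomial.algebraMap_eq]
  | add p q hp hq => simp [hp, hq]
  | mul_X p i hp =>
    rw [map_mul, Polynomial.eval_mul, map_mul, hp, beta_alpha_X]

lemma alpha_injective : Function.Injective (alphaHom K) := by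
  intro p q h
  rw [← beta_alpha p, h, beta_alpha]

lemma alpha_C (a : K) : alphaHom K (MvPolynomial.C a) = Polynomial.C (MvPolynomial.C a) := by
  simp [alphaHom, MvPolynomial.algebraMap_eq, Polynomial.algebraMap_apply]

lemma alpha_homog (p : MvPolynomial (Fin 3) K) : ∀ n, ((alphaHom K p).coeff n).IsHomogeneous n := by
  induction p using MvPolynomial.induction_on with
  | C a =>
    intro n
    rw [alpha_C, Polynomial.coeff_C]
    split_ifs with h
    · subst h; exact MvPolynomial.isHomogeneous_C _ _
    · exact MvPolynomial.isHomogeneous_zero _ _ _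
  | add p q hp hq =>
    intro n
    rw [map_add, Polynomial.coeff_add]
    exact (hp n).add (hq n)
  | mul_X p i hp =>
    intro n
    obtain ⟨b, hb, e⟩ : ∃ b : MvPolynomial (Fin 3) K, b.IsHomogeneous 1 ∧
        alphaHom K (MvPolynomial.X i) = Polynomial.C b * Polynomial.X := by
      fin_cases i
      · exact ⟨_, (MvPolynomial.isHomogeneous_X K 0).add (MvPolynomial.isHomogeneous_X K 2),
          by simp [alphaHom]⟩
      · exact ⟨_, (MvPolynomial.isHomogeneous_X K 1).add (MvPolynomial.isHomogeneous_X K 2),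
          by simp [alphaHom]⟩
      · exact ⟨_, (MvPolynomial.isHomogeneous_X K 2), by simp [alphaHom]⟩
    rw [map_mul, e, ← mul_assoc]
    rcases n with _ | n
    · simpa using MvPolynomial.isHomogeneous_zero _ _ _
    · rw [Polynomial.coeff_mul_X, Polynomial.coeff_mul_C]
      exact (hp n).mul hb

lemma alpha_denom : alphaHom K (denom K) = Polynomial.C (newDen K) * Polynomial.X ^ 3 := by
  simp only [denom, newDen, map_mul, map_add, alpha_X0, alpha_X1, alpha_X2]
  set u : Polynomial (MvPolynomial (Fin 3) K) := Polynomial.C (MvPolynomial.X 0)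
  set v : Polynomial (MvPolynomial (Fin 3) K) := Polynomial.C (MvPolynomial.X 1)
  set z : Polynomial (MvPolynomial (Fin 3) K) := Polynomial.C (MvPolynomial.X 2)
  linear_combination (Polynomial.X ^ 3 * (3 * u * v * z + 4 * u * z ^ 2 + u ^ 2 * z + v ^ 2 * z
    + 4 * v * z ^ 2 + 4 * z ^ 3)) * two_AT (K := K)

lemma coeff_aeval_lin (f : Polynomial K) (b : MvPolynomial (Fin 3) K) (n : ℕ) :
    (Polynomial.aeval (Polynomial.C b * Polynomial.X) f).coeff n
      = MvPolynomial.C (f.coeff n) * b ^ n := by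
  induction f using Polynomial.induction_on' with
  | add p q hp hq => simp [hp, hq, add_mul]
  | monomial m a =>
    rw [Polynomial.aeval_monomial, mul_pow, ← Polynomial.C_pow, Polynomial.algebraMap_apply,
      ← mul_assoc, ← Polynomial.C_mul, Polynomial.coeff_C_mul_X_pow, Polynomial.coeff_monomial,
      MvPolynomial.algebraMap_eq]
    by_cases h : m = n
    · subst h; simp
    · simp [h, Ne.symm h]

lemma alpha_numer (f : Polynomial K) (n : ℕ) :
    (alphaHom K (numer K f)).coeff (n + 1) = MvPolynomial.C (f.coeff n) * newNum K n := by
  have key : ∀ (a : MvPolynomial (Fin 3) K) (g : Polynomial (MvPolynomial (Fin 3) K)),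
      (Polynomial.C a * Polynomial.X * g).coeff (n + 1) = a * g.coeff n := by
    intro a g
    rw [mul_assoc, Polynomial.coeff_C_mul, Polynomial.coeff_X_mul]
  simp only [numer, map_add, map_mul, ← Polynomial.aeval_algHom_apply, alpha_X0, alpha_X1, alpha_X2,
    Polynomial.coeff_add]
  simp only [← map_add, key, Polynomial.coeff_add, coeff_aeval_lin, newNum]
  linear_combination (MvPolynomial.C (f.coeff n) * MvPolynomial.X 2 *
    ((MvPolynomial.X 1 + MvPolynomial.X 2)^n + (MvPolynomial.X 0 + MvPolynomial.X 2)^n +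
      MvPolynomial.X 2 ^ n)) * two_A (K := K)

lemma numerMon_eq (j : ℕ) : numerMon K j = numer K (Polynomial.X ^ j) := by
  simp [numerMon, numer]

lemma comp_eq (f : Polynomial K) (Φ : MvPolynomial (Fin 3) K) (h : denom K * Φ = numer K f)
    (n : ℕ) : newDen K * (alphaHom K Φ).coeff n =
      MvPolynomial.C (f.coeff (n + 2)) * newNum K (n + 2) := by
  rw [← alpha_numer, ← h, map_mul, alpha_denom, mul_assoc, Polynomial.coeff_C_mul,
    Polynomial.coeff_X_pow_mul]

lemma newNum_pow (k : ℕ) : newNum K (2 ^ k) = MvPolynomial.X 0 * MvPolynomial.X 1 ^ (2 ^ k)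
      + MvPolynomial.X 1 * MvPolynomial.X 0 ^ (2 ^ k) := by
  simp only [newNum, add_pow_char_pow]
  linear_combination (MvPolynomial.X 2 ^ 2 ^ k * (MvPolynomial.X 0 + MvPolynomial.X 1)) *
    two_A (K := K)

lemma newDen_ne : newDen K ≠ 0 := by
  intro h
  have h2 := congrArg (MvPolynomial.aeval ![(Polynomial.X : Polynomial K), 1, 0]) h
  simp [newDen] at h2
  have h3 := congrArg (Polynomial.eval 0) h2
  simp at h3

end char2

section core
set_option linter.unusedSectionVars false
variable {K : Type*} [Field K] [CharP K 2]

lemma lin_irreducible (θ : K) :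
    Irreducible (MvPolynomial.X 0 + MvPolynomial.C θ * MvPolynomial.X 1 :
      MvPolynomial (Fin 3) K) := by
  have hc : MvPolynomial.coeff (Finsupp.single 0 1)
      (MvPolynomial.X 0 + MvPolynomial.C θ * MvPolynomial.X 1 : MvPolynomial (Fin 3) K) = 1 := by
    rw [MvPolynomial.coeff_add, MvPolynomial.coeff_C_mul, MvPolynomial.coeff_X,
      MvPolynomial.coeff_X]
    simp [Finsupp.single_left_inj]
  apply MvPolynomial.irreducible_of_totalDegree_eq_one
  · apply MvPolynomial.IsHomogeneous.totalDegree
    · exact (MvPolynomial.isHomogeneous_X K 0).add ((MvPolynomial.isHomogeneous_X K 1).C_mul θ)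
    · intro h
      rw [h] at hc
      simp at hc
  · intro x hx
    have := hx (Finsupp.single 0 1)
    rw [hc] at this
    exact isUnit_of_dvd_one this

lemma sq_zero {k : ℕ} (hk : 1 ≤ k) {a : K} (ha : a ≠ 0) (l φ : MvPolynomial (Fin 3) K)
    (hφ : newDen K * φ = MvPolynomial.C a * newNum K (2 ^ k))
    (hl : l * l ∣ newDen K * φ) (w : Fin 3 → K) (hw : MvPolynomial.eval w l = 0) :
    w 0 = 0 ∧ w 1 = 0 := by
  obtain ⟨c, hc⟩ := hl
  refine lin_sq_not_dvd hk l (MvPolynomial.C a⁻¹ * c) ?_ w hw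
  rw [← newNum_pow]
  have h1 : (MvPolynomial.C a⁻¹ * MvPolynomial.C a : MvPolynomial (Fin 3) K) = 1 := by
    rw [← MvPolynomial.C_mul, inv_mul_cancel₀ ha, MvPolynomial.C_1]
  linear_combination newNum K (2 ^ k) * h1 + MvPolynomial.C a⁻¹ * hφ - MvPolynomial.C a⁻¹ * hc

lemma prime_top [IsAlgClosed K] {k : ℕ} (hk : 1 ≤ k) {a : K} (ha : a ≠ 0)
    (p φ : MvPolynomial (Fin 3) K)
    (hφ : newDen K * φ = MvPolynomial.C a * newNum K (2 ^ k)) (hp : Prime p) (hpφ : p ∣ φ) :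
    (∃ θ : K, θ ^ (2 ^ k) = θ ∧ θ ≠ 0 ∧ θ ≠ 1 ∧
      (MvPolynomial.X 0 + MvPolynomial.C θ * MvPolynomial.X 1) ∣ p) ∧ ¬ p * p ∣ φ := by
  have hq : 1 < 2 ^ k := Nat.one_lt_two_pow (by omega)
  have hd : p ∣ MvPolynomial.X 0 * MvPolynomial.X 1 ^ (2 ^ k)
      + MvPolynomial.X 1 * MvPolynomial.X 0 ^ (2 ^ k) := by
    have h1 : p ∣ MvPolynomial.C a * newNum K (2 ^ k) := hφ ▸ Dvd.dvd.mul_left hpφ _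
    rw [← newNum_pow]
    have hu : IsUnit (MvPolynomial.C a : MvPolynomial (Fin 3) K) :=
      (isUnit_iff_ne_zero.mpr ha).map MvPolynomial.C
    exact (hu.dvd_mul_left).mp h1
  rcases prime_dvd_lin hq _ _ p (MvPolynomial.X_ne_zero 1) hp hd with h | ⟨θ, hθ, h⟩
  · exfalso
    have h1 : (MvPolynomial.X 1 : MvPolynomial (Fin 3) K) ∣ p :=
      ((hp.irreducible.associated_of_dvd (MvPolynomial.X_prime (i := (1 : Fin 3))).irreducible h)).symm.dvd
    have h2 : (MvPolynomial.X 1 * MvPolynomial.X 1 : MvPolynomial (Fin 3) K) ∣ newDen K * φ :=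
      mul_dvd_mul (Dvd.intro_left _ rfl) (h1.trans hpφ)
    have := sq_zero hk ha _ φ hφ h2 ![1, 0, 0] (by simp)
    simp at this
  · have h1 := (hp.irreducible.associated_of_dvd (lin_irreducible θ) h).symm.dvd
    have hev : MvPolynomial.eval ![θ, 1, 0]
        (MvPolynomial.X 0 + MvPolynomial.C θ * MvPolynomial.X 1 : MvPolynomial (Fin 3) K) = 0 := by
      simp [CharTwo.add_self_eq_zero]
    have hno : ¬ (MvPolynomial.X 0 + MvPolynomial.C θ * MvPolynomial.X 1) *
        (MvPolynomial.X 0 + MvPolynomial.C θ * MvPolynomial.X 1) ∣ newDen K * φ := by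
      intro h2
      have := sq_zero hk ha _ φ hφ h2 ![θ, 1, 0] hev
      simp at this
    refine ⟨⟨θ, hθ, ?_, ?_, h1⟩, ?_⟩
    · rintro rfl
      apply hno
      refine mul_dvd_mul ?_ (h1.trans hpφ)
      simp only [map_zero, zero_mul, add_zero, newDen]
      exact ⟨(MvPolynomial.X 0 + MvPolynomial.X 1) * MvPolynomial.X 1, by ring⟩
    · rintro rfl
      apply hno
      refine mul_dvd_mul ?_ (h1.trans hpφ)
      simp only [map_one, one_mul, newDen]
      exact ⟨MvPolynomial.X 0 * MvPolynomial.X 1, by ring⟩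
    · intro h2
      exact hno (((mul_dvd_mul h1 h1).trans h2).mul_left _)

lemma zfree {k : ℕ} {a : K}
    (Q φ : MvPolynomial (Fin 3) K)
    (hφ : newDen K * φ = MvPolynomial.C a * newNum K (2 ^ k)) (h0 : φ ≠ 0) (hQ : Q ∣ φ) :
    MvPolynomial.degreeOf 2 Q = 0 := by
  have h1 : Q ∣ newDen K * φ := hQ.mul_left _
  have h2 : newDen K * φ ≠ 0 := mul_ne_zero newDen_ne h0
  obtain ⟨c, hc⟩ := h1
  have hQ0 : Q ≠ 0 := by rintro rfl; simp [hc] at h2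
  have hc0 : c ≠ 0 := by rintro rfl; simp [hc] at h2
  have h3 := MvPolynomial.degreeOf_mul_eq (n := (2 : Fin 3)) hQ0 hc0
  rw [← hc, hφ, newNum_pow] at h3
  have hX : ∀ i : Fin 3, i ≠ 2 → ∀ m : ℕ, MvPolynomial.degreeOf 2
      (MvPolynomial.X i ^ m : MvPolynomial (Fin 3) K) = 0 := by
    intro i hi m
    exact MvPolynomial.degreeOf_X_pow_of_ne m hi.symm
  have hX1 : ∀ i : Fin 3, i ≠ 2 → MvPolynomial.degreeOf 2
      (MvPolynomial.X i : MvPolynomial (Fin 3) K) = 0 := by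
    intro i hi
    exact MvPolynomial.degreeOf_X_of_ne hi.symm
  have h4 : MvPolynomial.degreeOf 2 (MvPolynomial.C a *
      (MvPolynomial.X 0 * MvPolynomial.X 1 ^ (2 ^ k)
      + MvPolynomial.X 1 * MvPolynomial.X 0 ^ (2 ^ k)) : MvPolynomial (Fin 3) K) ≤ 0 := by
    refine (MvPolynomial.degreeOf_C_mul_le _ _ _).trans ?_
    refine (MvPolynomial.degreeOf_add_le _ _ _).trans ?_
    refine max_le ?_ ?_
    · refine (MvPolynomial.degreeOf_mul_le _ _ _).trans ?_
      rw [hX 1 (by decide), hX1 0 (by decide)]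
    · refine (MvPolynomial.degreeOf_mul_le _ _ _).trans ?_
      rw [hX 0 (by decide), hX1 1 (by decide)]
  omega

/-- Restriction to the plane `u = θ v`, with `z = 1`. -/
noncomputable def sigmaHom (θ : K) : MvPolynomial (Fin 3) K →ₐ[K] Polynomial K :=
  MvPolynomial.aeval ![Polynomial.C θ * Polynomial.X, Polynomial.X, 1]

lemma sigma_dvd (θ : K) (Q : MvPolynomial (Fin 3) K) (t : ℕ) (hQ : Q.IsHomogeneous t)
    (h2 : MvPolynomial.degreeOf 2 Q = 0) : Polynomial.X ^ t ∣ sigmaHom θ Q := by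
  rw [MvPolynomial.as_sum Q, map_sum]
  apply Finset.dvd_sum
  intro d hd
  have hd2 : d 2 = 0 := by
    have := MvPolynomial.monomial_le_degreeOf 2 hd
    omega
  have ht := hQ.degree_eq_sum_deg_support hd
  have ht' : d 0 + d 1 = t := by
    rw [ht, ← Finsupp.degree_apply, Finsupp.degree_eq_sum, Fin.sum_univ_three, hd2, add_zero]
  rw [sigmaHom, MvPolynomial.aeval_monomial, Finsupp.prod_fintype _ _ (by simp),
    Fin.prod_univ_three]
  simp only [Matrix.cons_val_zero, Matrix.cons_val_one, Matrix.cons_val, one_pow, mul_one]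
  rw [← ht', mul_pow, pow_add]
  exact ⟨algebraMap K (Polynomial K) (MvPolynomial.coeff d Q) * Polynomial.C θ ^ d 0, by ring⟩

lemma choose_odd (k j : ℕ) (h1 : 2 ^ k ≤ j) (h2 : j < 2 ^ (k + 1)) :
    ((j.choose (2 ^ k) : ℕ) : K) = 1 := by
  obtain ⟨r, rfl⟩ := Nat.exists_eq_add_of_le h1
  have hr : r < 2 ^ k := by rw [pow_succ] at h2; omega
  rw [← Polynomial.coeff_X_add_one_pow, pow_add, add_pow_char_pow, one_pow, add_mul, one_mul,
    Polynomial.coeff_add]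
  have e1 : ((Polynomial.X + 1 : Polynomial K) ^ r).coeff (2 ^ k) = 0 := by
    rw [Polynomial.coeff_X_add_one_pow, Nat.choose_eq_zero_of_lt hr, Nat.cast_zero]
  have e2 := Polynomial.coeff_X_pow_mul ((Polynomial.X + 1 : Polynomial K) ^ r) (2 ^ k) 0
  rw [zero_add] at e2
  rw [e1, e2, Polynomial.coeff_X_add_one_pow]
  simp

lemma sigma_newNum (θ : K) (k j : ℕ) (h1 : 2 ^ k ≤ j) (h2 : j < 2 ^ (k + 1)) :
    (sigmaHom θ (newNum K j)).coeff (2 ^ k + 1) = θ + θ ^ (2 ^ k) := by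
  have hne : (2 : ℕ) ^ k ≠ 0 := by positivity
  have e : sigmaHom θ (newNum K j) = Polynomial.X * (Polynomial.C θ * ((Polynomial.X + 1) ^ j + 1) +
      (((Polynomial.X + 1) ^ j).comp (Polynomial.C θ * Polynomial.X) + 1)) := by
    simp [sigmaHom, newNum]
    ring
  rw [e, Polynomial.coeff_X_mul]
  simp only [Polynomial.coeff_add, Polynomial.coeff_C_mul, Polynomial.comp_C_mul_X_coeff,
    Polynomial.coeff_X_add_one_pow, choose_odd k j h1 h2, Polynomial.coeff_one, hne]
  simp

end core

section final
set_option linter.unusedSectionVars false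
variable {K : Type*} [Field K] [CharP K 2]

lemma newNum_pow_ne (k : ℕ) (hk : 1 ≤ k) : newNum K (2 ^ k) ≠ 0 := by
  intro h
  have h2 := congrArg (MvPolynomial.aeval ![(Polynomial.X : Polynomial K), 1, 0]) h
  rw [newNum_pow] at h2
  simp at h2
  have h3 := congrArg (fun P => Polynomial.coeff P 1) h2
  have : (1 : ℕ) ≠ 2 ^ k := (Nat.one_lt_two_pow (by omega)).ne
  simp [Polynomial.coeff_X_pow, this] at h3

lemma coeff_mul_two_terms {A : Type*} [CommRing A] (p q : Polynomial A) (n : ℕ) (hn : 0 < n)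
    (h : ∀ m, 0 < m → m < n → p.coeff m = 0) :
    (p * q).coeff n = p.coeff 0 * q.coeff n + p.coeff n * q.coeff 0 := by
  rw [Polynomial.coeff_mul]
  apply Finset.sum_eq_add (0, n) (n, 0)
  · intro e
    simp only [Prod.mk.injEq] at e
    omega
  · rintro ⟨a, b⟩ hab ⟨h1, h2⟩
    have hab : a + b = n := by simpa using hab
    have ha : 0 < a := by
      rcases Nat.eq_zero_or_pos a with rfl | ha
      · exact absurd (by simpa using hab) h1
      · exact ha
    have ha' : a < n := by
      rcases lt_or_ge a n with ha' | ha'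
      · exact ha'
      · exact absurd (by simp only [Prod.mk.injEq]; omega) h2
    simp [h a ha ha']
  · intro e; simp at e
  · intro e; simp at e

lemma rev_zero_of_dvd (P : MvPolynomial (Fin 3) K) (n : ℕ) (hn : 0 < n)
    (hd : (alphaHom K P).reverse.coeff 0 ∣ (alphaHom K P).reverse.coeff n)
    (h0 : (alphaHom K P).reverse.coeff 0 ≠ 0) : (alphaHom K P).reverse.coeff n = 0 := by
  by_contra hne
  have h1 := MvPolynomial.totalDegree_le_of_dvd_of_isDomain hd hne
  rw [Polynomial.coeff_reverse, Polynomial.coeff_reverse] at h1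
  rw [Polynomial.coeff_reverse] at h0 hne
  rw [(alpha_homog P _).totalDegree h0, (alpha_homog P _).totalDegree hne,
    Polynomial.revAt_le (Nat.zero_le _)] at h1
  rcases le_or_gt n (alphaHom K P).natDegree with h | h
  · rw [Polynomial.revAt_le h] at h1 hne
    omega
  · rw [Polynomial.revAt_eq_self_of_lt h] at hne
    exact hne (Polynomial.coeff_eq_zero_of_natDegree_lt h)

set_option maxHeartbeats 1000000 in
theorem core_thm [IsAlgClosed K] {k : ℕ} (hk : 2 ≤ k) (f : Polynomial K)
    (hdeg : ∀ i, f.coeff i ≠ 0 → i ≤ 2 ^ k) (hlead : f.coeff (2 ^ k) ≠ 0)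
    (P Q : MvPolynomial (Fin 3) K) (hPQ : denom K * (P * Q) = numer K f) (hP : ¬ IsUnit P)
    (hst : (alphaHom K P).natDegree ≤ (alphaHom K Q).natDegree) :
    ∃ θ : K, θ ^ (2 ^ k) = θ ∧ θ ≠ 0 ∧ θ ≠ 1 ∧ ∀ j, 2 ≤ j → f.coeff j = 0 ∨
      ∀ ψ : MvPolynomial (Fin 3) K, denom K * ψ = numerMon K j →
        (MvPolynomial.X 0 + MvPolynomial.X 2 +
              MvPolynomial.C θ * (MvPolynomial.X 1 + MvPolynomial.X 2)) ∣ ψ := by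
  obtain ⟨m, rfl⟩ : ∃ m, k = m + 1 := ⟨k - 1, by omega⟩
  have hm : 2 ≤ 2 ^ m := by
    calc 2 = 2 ^ 1 := rfl
      _ ≤ 2 ^ m := Nat.pow_le_pow_right (by norm_num) (by omega)
  have hq2 : 2 ^ (m + 1) = 2 * 2 ^ m := by ring
  set W := alphaHom K (P * Q) with hWdef
  have hWmul : W = alphaHom K P * alphaHom K Q := by rw [hWdef, map_mul]
  have hW : ∀ n, newDen K * W.coeff n = MvPolynomial.C (f.coeff (n + 2)) * newNum K (n + 2) :=
    comp_eq f _ hPQ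
  have hWtop : newDen K * W.coeff (2 ^ (m + 1) - 2) =
      MvPolynomial.C (f.coeff (2 ^ (m + 1))) * newNum K (2 ^ (m + 1)) := by
    have := hW (2 ^ (m + 1) - 2)
    rwa [show 2 ^ (m + 1) - 2 + 2 = 2 ^ (m + 1) by omega] at this
  have hWne : W.coeff (2 ^ (m + 1) - 2) ≠ 0 := by
    intro h
    rw [h, mul_zero] at hWtop
    rcases mul_eq_zero.mp hWtop.symm with h | h
    · exact hlead (by simpa using h)
    · exact newNum_pow_ne _ (by omega) h
  have hWz : ∀ n, 2 ^ (m + 1) - 2 < n → W.coeff n = 0 := by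
    intro n hn
    have h1 := hW n
    have h2 : f.coeff (n + 2) = 0 := by
      by_contra h
      have := hdeg _ h
      omega
    rw [h2, map_zero, zero_mul] at h1
    exact (mul_eq_zero.mp h1).resolve_left newDen_ne
  have hWdeg : W.natDegree = 2 ^ (m + 1) - 2 :=
    le_antisymm (Polynomial.natDegree_le_iff_coeff_eq_zero.mpr hWz)
      (Polynomial.le_natDegree_of_ne_zero hWne)
  have hW0 : W ≠ 0 := by rintro h; rw [h] at hWne; simp at hWne
  have hP0 : alphaHom K P ≠ 0 := by intro h; rw [hWmul, h, zero_mul] at hW0; exact hW0 rfl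
  have hQ0 : alphaHom K Q ≠ 0 := by intro h; rw [hWmul, h, mul_zero] at hW0; exact hW0 rfl
  have hsum : (alphaHom K P).natDegree + (alphaHom K Q).natDegree = 2 ^ (m + 1) - 2 := by
    rw [← Polynomial.natDegree_mul hP0 hQ0, ← hWmul, hWdeg]
  set s := (alphaHom K P).natDegree with hs
  set t := (alphaHom K Q).natDegree with ht
  have hs1 : 1 ≤ s := by
    by_contra h
    have h0 : s = 0 := by omega
    have h1 := Polynomial.eq_C_of_natDegree_eq_zero h0
    have h2 := (alpha_homog P 0)
    have h3 := MvPolynomial.totalDegree_eq_zero_iff_eq_C.mp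
      (Nat.le_zero.mp h2.totalDegree_le)
    rw [h3, ← alpha_C] at h1
    have h4 := alpha_injective h1
    apply hP
    rw [h4]
    apply IsUnit.map
    rw [isUnit_iff_ne_zero]
    intro h5
    rw [h5] at h1
    simp at h1
    exact hP0 h1
  set p := (alphaHom K P).reverse with hp
  set q := (alphaHom K Q).reverse with hq
  have hrev : W.reverse = p * q := by
    rw [hWmul, Polynomial.reverse_mul_of_domain]
  have hpc : p.coeff 0 = (alphaHom K P).leadingCoeff := Polynomial.coeff_zero_reverse _
  have hqc : q.coeff 0 = (alphaHom K Q).leadingCoeff := Polynomial.coeff_zero_reverse _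
  have hp0 : p.coeff 0 ≠ 0 := by rw [hpc]; simpa using hP0
  have hq0 : q.coeff 0 ≠ 0 := by rw [hqc]; simpa using hQ0
  have hpq : p.coeff 0 * q.coeff 0 = W.coeff (2 ^ (m + 1) - 2) := by
    rw [hpc, hqc, ← Polynomial.leadingCoeff_mul, ← hWmul, Polynomial.leadingCoeff, hWdeg]
  have hrel : IsRelPrime (p.coeff 0) (q.coeff 0) := by
    apply WfDvdMonoid.isRelPrime_of_no_irreducible_factors (fun h => hp0 h.1)
    intro π hπ h1 h2
    have hpp : π * π ∣ W.coeff (2 ^ (m + 1) - 2) := hpq ▸ mul_dvd_mul h1 h2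
    exact (prime_top (by omega) hlead π _ hWtop
      (UniqueFactorizationMonoid.irreducible_iff_prime.mp hπ)
      ((Dvd.intro _ rfl).trans hpp)).2 hpp
  have hvan : ∀ n, 0 < n → (∀ i, 0 < i → i ≤ n → (p * q).coeff i = 0) →
      p.coeff n = 0 ∧ q.coeff n = 0 := by
    intro n
    induction n using Nat.strong_induction_on with
    | _ n ih =>
      intro hn hz
      have h1 := coeff_mul_two_terms p q n hn (fun i hi hin =>
        (ih i hin hi (fun l hl hli => hz l hl (by omega))).1)
      rw [hz n hn le_rfl] at h1
      constructor
      · apply rev_zero_of_dvd P n hn _ hp0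
        apply hrel.dvd_of_dvd_mul_right (y := p.coeff n)
        exact ⟨- q.coeff n, by linear_combination - h1⟩
      · apply rev_zero_of_dvd Q n hn _ hq0
        apply hrel.symm.dvd_of_dvd_mul_left (z := q.coeff n)
        exact ⟨- p.coeff n, by linear_combination - h1⟩
  -- a linear factor of the leading form of P
  have hpunit : ¬ IsUnit (p.coeff 0) := by
    intro h
    have h1 := (MvPolynomial.isUnit_iff_totalDegree_of_isReduced.mp h).2
    rw [hpc] at h1
    rw [hpc] at hp0
    rw [Polynomial.leadingCoeff, (alpha_homog P _).totalDegree hp0] at h1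
    omega
  obtain ⟨π, hπ, hπp⟩ := WfDvdMonoid.exists_irreducible_factor hpunit hp0
  obtain ⟨⟨θ, hθ, hθ0, hθ1, hl⟩, -⟩ := prime_top (by omega) hlead π _ hWtop
    (UniqueFactorizationMonoid.irreducible_iff_prime.mp hπ)
    (hpq ▸ hπp.mul_right _)
  have hlp := hl.trans hπp
  have hsig0 : sigmaHom θ (MvPolynomial.X 0 + MvPolynomial.C θ * MvPolynomial.X 1) = 0 := by
    rw [map_add, map_mul, ← MvPolynomial.algebraMap_eq, AlgHom.commutes]
    simp [sigmaHom, CharTwo.add_self_eq_zero]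
  by_cases hcase : ∃ n, 0 < n ∧ n ≤ s ∧ (p * q).coeff n ≠ 0
  · -- impossible case
    exfalso
    classical
    obtain ⟨hn0, hns, hnz⟩ := Nat.find_spec hcase
    have hmin := fun i (hi : i < Nat.find hcase) => Nat.find_min hcase hi
    set n := Nat.find hcase
    have hz : ∀ i, 0 < i → i < n → (p * q).coeff i = 0 := by
      intro i hi hin
      by_contra h
      exact hmin i hin ⟨hi, by omega, h⟩
    have h1 := coeff_mul_two_terms p q n hn0 (fun i hi hin =>
        (hvan i hi (fun l hl hli => hz l hl (by omega))).1)
    have h2 : (p * q).coeff n = W.coeff (2 ^ (m + 1) - 2 - n) := by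
      rw [← hrev, Polynomial.coeff_reverse, hWdeg, Polynomial.revAt_le (by omega)]
    have h3 := hW (2 ^ (m + 1) - 2 - n)
    rw [← h2] at h3
    obtain ⟨j, hj⟩ : ∃ j, j = 2 ^ (m + 1) - 2 - n + 2 := ⟨_, rfl⟩
    rw [← hj] at h3
    have hfj : f.coeff j ≠ 0 := by
      intro h
      rw [h, map_zero, zero_mul] at h3
      exact hnz ((mul_eq_zero.mp h3).resolve_left newDen_ne)
    have h4 := congrArg (sigmaHom θ) h3
    have hsp : sigmaHom θ (p.coeff 0) = 0 := by
      obtain ⟨c, hc⟩ := hlp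
      rw [hc, map_mul, hsig0, zero_mul]
    have hqd : Polynomial.X ^ t ∣ sigmaHom θ (q.coeff 0) := by
      apply sigma_dvd
      · rw [hqc]; exact alpha_homog Q _
      · exact zfree _ _ hWtop hWne (hpq ▸ Dvd.intro_left _ rfl)
    have hdd : Polynomial.X ^ 3 ∣ sigmaHom θ (newDen K) := by
      refine ⟨(Polynomial.C θ + 1) * Polynomial.C θ, ?_⟩
      simp [sigmaHom, newDen]
      ring
    have h5 : Polynomial.X ^ (3 + t) ∣ sigmaHom θ (MvPolynomial.C (f.coeff j) * newNum K j) := by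
      rw [← h4, h1, map_mul, map_add, map_mul, map_mul, hsp, zero_mul, zero_add, pow_add]
      exact mul_dvd_mul hdd (hqd.mul_left _)
    have h6 := Polynomial.X_pow_dvd_iff.mp h5 (2 ^ m + 1) (by omega)
    rw [map_mul, ← MvPolynomial.algebraMap_eq, AlgHom.commutes, Polynomial.algebraMap_eq,
      Polynomial.coeff_C_mul, sigma_newNum θ m j (by omega) (by omega)] at h6
    have h7 := (mul_eq_zero.mp h6).resolve_left hfj
    have h8 : θ ^ 2 ^ m = θ := (CharTwo.add_eq_zero.mp h7).symm
    rw [pow_succ, pow_mul, h8] at hθ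
    have h9 : θ * (θ - 1) = 0 := by linear_combination hθ
    rcases mul_eq_zero.mp h9 with h | h
    · exact hθ0 h
    · exact hθ1 (sub_eq_zero.mp h)
  · push Not at hcase
    refine ⟨θ, hθ, hθ0, hθ1, ?_⟩
    set l : MvPolynomial (Fin 3) K := MvPolynomial.X 0 + MvPolynomial.C θ * MvPolynomial.X 1
      with hldef
    have hlP : Polynomial.C l ∣ alphaHom K P := by
      rw [Polynomial.C_dvd_iff_dvd_coeff]
      intro i
      rcases lt_or_ge s i with h | h
      · rw [Polynomial.coeff_eq_zero_of_natDegree_lt h]; exact dvd_zero _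
      · have e : (alphaHom K P).coeff i = p.coeff (s - i) := by
          rw [hp, Polynomial.coeff_reverse, ← hs, Polynomial.revAt_le (by omega)]
          congr 1; omega
        rw [e]
        rcases Nat.eq_zero_or_pos (s - i) with h0 | h0
        · rw [h0]; exact hlp
        · rw [(hvan _ h0 (fun i' hi' hi'' => hcase i' hi' (by omega))).1]
          exact dvd_zero _
    have hlW : ∀ n, l ∣ W.coeff n := by
      rw [← Polynomial.C_dvd_iff_dvd_coeff, hWmul]
      exact hlP.mul_right _
    intro j hj
    by_cases hfj : f.coeff j = 0
    · exact Or.inl hfj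
    right
    intro ψ hψ
    rw [numerMon_eq] at hψ
    have hψc := comp_eq _ ψ hψ
    have hlψ : Polynomial.C l ∣ alphaHom K ψ := by
      rw [Polynomial.C_dvd_iff_dvd_coeff]
      intro n
      have h1 := hψc n
      rw [Polynomial.coeff_X_pow] at h1
      split_ifs at h1 with h
      · have h2 := hW n
        have h3 : W.coeff n = MvPolynomial.C (f.coeff (n + 2)) * (alphaHom K ψ).coeff n := by
          apply mul_left_cancel₀ (newDen_ne (K := K))
          rw [h2, mul_left_comm, h1, map_one, one_mul]
        have h4 := hlW n
        rw [h3, h] at h4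
        have hu : IsUnit (MvPolynomial.C (f.coeff j) : MvPolynomial (Fin 3) K) :=
          (isUnit_iff_ne_zero.mpr hfj).map MvPolynomial.C
        exact (hu.dvd_mul_left).mp h4
      · rw [map_zero, zero_mul] at h1
        rw [(mul_eq_zero.mp h1).resolve_left newDen_ne]
        exact dvd_zero _
    obtain ⟨c, hc⟩ := hlψ
    refine ⟨betaHom K (c.eval 1), ?_⟩
    rw [← beta_alpha ψ, hc, Polynomial.eval_mul, map_mul, Polynomial.eval_C, hldef, map_add,
      map_mul, beta_X0, beta_X1, ← MvPolynomial.algebraMap_eq, AlgHom.commutes]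

lemma map_denom {F : Type*} [Field F] [Algebra F K] :
    MvPolynomial.map (algebraMap F K) (denom F) = denom K := by
  simp [denom]

lemma map_aeval_X {F : Type*} [Field F] [Algebra F K] (f : Polynomial F) (i : Fin 3) :
    MvPolynomial.map (algebraMap F K) (Polynomial.aeval (MvPolynomial.X i) f) =
      Polynomial.aeval (MvPolynomial.X i) (f.map (algebraMap F K)) := by
  induction f using Polynomial.induction_on' with
  | add p q hp hq => simp only [map_add, hp, hq, Polynomial.map_add]
  | monomial n a =>
    simp [Polynomial.aeval_monomial, MvPolynomial.algebraMap_eq, Polynomial.map_monomial]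

lemma map_numer {F : Type*} [Field F] [Algebra F K] (f : Polynomial F) :
    MvPolynomial.map (algebraMap F K) (numer F f) = numer K (f.map (algebraMap F K)) := by
  simp only [numer, map_add, map_mul, MvPolynomial.map_X, map_aeval_X]

lemma map_numerMon {F : Type*} [Field F] [Algebra F K] (j : ℕ) :
    MvPolynomial.map (algebraMap F K) (numerMon F j) = numerMon K j := by
  simp [numerMon]

end final

theorem Phi_not_unit {K : Type*} [Field K] [CharP K 2] {k : ℕ} (hk : 2 ≤ k) (f : Polynomial K)
    (hlead : f.coeff (2 ^ k) ≠ 0) (Φ : MvPolynomial (Fin 3) K)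
    (h : denom K * Φ = numer K f) : ¬ IsUnit Φ := by
  intro hu
  have hq : 4 ≤ 2 ^ k := by
    calc 4 = 2 ^ 2 := rfl
      _ ≤ 2 ^ k := Nat.pow_le_pow_right (by norm_num) hk
  have h1 := comp_eq f Φ h (2 ^ k - 2)
  rw [show 2 ^ k - 2 + 2 = 2 ^ k by omega] at h1
  have h2 := MvPolynomial.totalDegree_eq_zero_iff_eq_C.mp
    (MvPolynomial.isUnit_iff_totalDegree_of_isReduced.mp hu).2
  rw [h2, alpha_C, Polynomial.coeff_C, if_neg (by omega), mul_zero] at h1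
  rcases mul_eq_zero.mp h1.symm with h | h
  · exact hlead (by simpa using h)
  · exact newNum_pow_ne _ (by omega) h

/-- Let `k ≥ 2` and let `f ∈ F_q[x]` be of the form `f(x) = Σ_{i=1}^{2^(k-1)} a_{2i} x^{2i}`
with `a_{2^k} ≠ 0`. If `Φ_f` is not absolutely irreducible, then there is
`θ ∈ F_{2^k} \ F_2` (inside the algebraic closure of `F_q`) such that for each
`i ∈ {1, …, 2^(k-1)}`, either `a_{2i} = 0` or `x + z + θ(y+z)` divides `φ_{2i}`
over the algebraic closure. -/
theorem Phi_reducible_common_factor (F : Type*) [Field F] [Finite F] (h k : ℕ)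
    (hh : 0 < h) (hq : Nat.card F = 2 ^ h) (hk : 2 ≤ k) (f : Polynomial F)
    (hform : ∀ i : ℕ, f.coeff i ≠ 0 → Even i ∧ 0 < i ∧ i ≤ 2 ^ k)
    (hlead : f.coeff (2 ^ k) ≠ 0)
    (Φ : MvPolynomial (Fin 3) F) (hΦ : denom F * Φ = numer F f)
    (hred : ¬ Irreducible (MvPolynomial.map (algebraMap F (AlgebraicClosure F)) Φ)) :
    ∃ θ : AlgebraicClosure F, θ ^ (2 ^ k) = θ ∧ θ ≠ 0 ∧ θ ≠ 1 ∧
      ∀ i ∈ Finset.Icc 1 (2 ^ (k - 1)), f.coeff (2 * i) = 0 ∨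
        ∀ ψ : MvPolynomial (Fin 3) F, denom F * ψ = numerMon F (2 * i) →
          (MvPolynomial.X 0 + MvPolynomial.X 2 +
              MvPolynomial.C θ * (MvPolynomial.X 1 + MvPolynomial.X 2)) ∣
            MvPolynomial.map (algebraMap F (AlgebraicClosure F)) ψ := by
  classical
  have : Fintype F := Fintype.ofFinite F
  have : Fact (Nat.Prime 2) := ⟨Nat.prime_two⟩
  have : CharP F 2 := charP_of_card_eq_prime_pow (f := h) (by rw [← Nat.card_eq_fintype_card, hq])
  have : CharP (AlgebraicClosure F) 2 := charP_of_injective_algebraMap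
    (algebraMap F (AlgebraicClosure F)).injective 2
  set K := AlgebraicClosure F
  set g : Polynomial K := f.map (algebraMap F K) with hg
  have hgc : ∀ i, g.coeff i = 0 ↔ f.coeff i = 0 := by
    intro i
    rw [hg, Polynomial.coeff_map]
    exact map_eq_zero _
  have hgdeg : ∀ i, g.coeff i ≠ 0 → i ≤ 2 ^ k := by
    intro i hi
    exact (hform i (fun h0 => hi ((hgc i).mpr h0))).2.2
  have hglead : g.coeff (2 ^ k) ≠ 0 := fun h0 => hlead ((hgc _).mp h0)
  set Ψ := MvPolynomial.map (algebraMap F K) Φ with hΨ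
  have hmain : denom K * Ψ = numer K g := by
    rw [hΨ, ← map_denom (F := F), ← map_mul, hΦ, map_numer]
  have hnu := Phi_not_unit hk g hglead Ψ hmain
  obtain ⟨P, Q, hPQ, hP, hQ⟩ : ∃ P Q, Ψ = P * Q ∧ ¬ IsUnit P ∧ ¬ IsUnit Q := by
    rw [irreducible_iff] at hred
    push Not at hred
    obtain ⟨P, Q, h1, h2⟩ := hred hnu
    exact ⟨P, Q, h1, h2⟩
  have hex : ∃ θ : K, θ ^ (2 ^ k) = θ ∧ θ ≠ 0 ∧ θ ≠ 1 ∧ ∀ j, 2 ≤ j → g.coeff j = 0 ∨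
      ∀ ψ : MvPolynomial (Fin 3) K, denom K * ψ = numerMon K j →
        (MvPolynomial.X 0 + MvPolynomial.X 2 +
              MvPolynomial.C θ * (MvPolynomial.X 1 + MvPolynomial.X 2)) ∣ ψ := by
    rcases le_total (alphaHom K P).natDegree (alphaHom K Q).natDegree with hle | hle
    · exact core_thm hk g hgdeg hglead P Q (by rw [← hPQ, hmain]) hP hle
    · exact core_thm hk g hgdeg hglead Q P (by rw [mul_comm Q P, ← hPQ, hmain]) hQ hle
  obtain ⟨θ, h1, h2, h3, h4⟩ := hex
  refine ⟨θ, h1, h2, h3, ?_⟩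
  intro i hi
  have hi1 := (Finset.mem_Icc.mp hi).1
  rcases h4 (2 * i) (by omega) with h5 | h5
  · exact Or.inl ((hgc _).mp h5)
  · right
    intro ψ hψ
    apply h5
    rw [← map_denom (F := F), ← map_mul, hψ, map_numerMon]
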